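/- arXiv:1612.03455 — 4 statements merged into one kernel-verified Lean document; each statement's English description precedes it below -/
import Mathlib

section
/- Let m be a positive integer, let A be an m×m real diagonal positive semidefinite matrix, and let M be an m×m real symmetric positive definite matrix. Then the diagonal part of (M⁻¹ + A)⁻¹ is dominated in the Loewner order by ((M_diag)⁻¹ + A)⁻¹, i.e., ((M⁻¹ + A)⁻¹)_diag ⪯ ((M_diag)⁻¹ + A)⁻¹. -/
open Matrix

/-- Cauchy–Schwarz for the quadratic form of a positive definite matrix and its inverse, tested
against a basis vector. -/
theorem Matrix.PosDef.sq_div_diag_le_dotProduct_inv_mulVec {n : Type*} [Fintype n]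
    [DecidableEq n] {M : Matrix n n ℝ} (hM : M.PosDef) (u : n → ℝ) (i : n) :
    u i ^ 2 / M i i ≤ u ⬝ᵥ (M⁻¹ *ᵥ u) := by
  have hii : 0 < M i i := hM.diag_pos
  have hdet : IsUnit M.det := (Matrix.isUnit_iff_isUnit_det M).mp hM.isUnit
  set t : ℝ := u i / M i i with ht
  have hsymm : Mᵀ = M := by simpa using hM.isHermitian.eq
  have hMu : M *ᵥ (M⁻¹ *ᵥ u) = u := by
    rw [mulVec_mulVec, mul_nonsing_inv _ hdet, one_mulVec]
  have hcross : (M⁻¹ *ᵥ u) ⬝ᵥ (M *ᵥ Pi.single i t) = t * u i := by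
    rw [dotProduct_mulVec, ← mulVec_transpose, hsymm, hMu, dotProduct_single, mul_comm]
  have h := hM.posSemidef.dotProduct_mulVec_nonneg (M⁻¹ *ᵥ u - Pi.single i t)
  rw [star_trivial, mulVec_sub, sub_dotProduct, dotProduct_sub, dotProduct_sub, hcross, hMu,
    single_dotProduct, single_dotProduct, dotProduct_comm _ u, mulVec_single] at h
  simp only [Pi.smul_apply, MulOpposite.smul_eq_mul_unop, MulOpposite.unop_op, col_apply] at h
  have hti : M i i * t = u i := by rw [ht]; field_simp
  have hsq : u i ^ 2 / M i i = t * u i := by rw [ht]; ring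
  rw [hti] at h
  linarith

/-- Each diagonal entry of `(M⁻¹ + diagonal d)⁻¹` is bounded by its value for the diagonal part
of `M`. -/
theorem Matrix.PosDef.inv_add_diagonal_inv_diag_le {n : Type*} [Fintype n] [DecidableEq n]
    {M : Matrix n n ℝ} (hM : M.PosDef) {d : n → ℝ} (hd : 0 ≤ d) (i : n) :
    (M⁻¹ + diagonal d)⁻¹ i i ≤ ((M i i)⁻¹ + d i)⁻¹ := by
  have hB : (M⁻¹ + diagonal d).PosDef := hM.inv.add_posSemidef (PosSemidef.diagonal hd)
  have hdet := (Matrix.isUnit_iff_isUnit_det _).mp hB.isUnit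
  have hs : 0 < (M⁻¹ + diagonal d)⁻¹ i i := hB.inv.diag_pos
  have hii : 0 < M i i := hM.diag_pos
  set u : n → ℝ := (M⁻¹ + diagonal d)⁻¹ *ᵥ Pi.single i 1 with hu
  have hui : u i = (M⁻¹ + diagonal d)⁻¹ i i := by simp [hu]
  have hBu : (M⁻¹ + diagonal d) *ᵥ u = Pi.single i 1 := by
    rw [hu, mulVec_mulVec, mul_nonsing_inv _ hdet, one_mulVec]
  have henergy : u ⬝ᵥ (M⁻¹ *ᵥ u) + u ⬝ᵥ (diagonal d *ᵥ u) = u i := by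
    rw [← dotProduct_add, ← add_mulVec, hBu, dotProduct_single, mul_one]
  have hdiag : d i * u i ^ 2 ≤ u ⬝ᵥ (diagonal d *ᵥ u) := by
    have hterm : ∀ j, u j * (diagonal d *ᵥ u) j = d j * u j ^ 2 := fun j => by
      rw [mulVec_diagonal]; ring
    simp only [dotProduct, hterm]
    exact Finset.single_le_sum (f := fun j => d j * u j ^ 2)
      (fun j _ => mul_nonneg (hd j) (sq_nonneg _)) (Finset.mem_univ i)
  have hcs := hM.sq_div_diag_le_dotProduct_inv_mulVec u i
  rw [← hui] at hs ⊢
  have hpos : 0 < (M i i)⁻¹ + d i := add_pos_of_pos_of_nonneg (inv_pos.mpr hii) (hd i)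
  rw [le_inv_comm₀ hs hpos, ← one_div (u i), le_div_iff₀ hs]
  refine le_of_mul_le_mul_right ?_ hs
  rw [div_eq_mul_inv] at hcs
  linarith

/-- Lemma (matrix inequality): for a diagonal PSD matrix `A` and a symmetric
positive definite matrix `M`, the diagonal part of `(M⁻¹ + A)⁻¹` is dominated
in the Loewner order by `((M_diag)⁻¹ + A)⁻¹`. -/
theorem diag_inv_add_le (m : ℕ) (hm : 0 < m)
    (A M : Matrix (Fin m) (Fin m) ℝ)
    (hA_diag : A.IsDiag) (hA : A.PosSemidef) (hM : M.PosDef) :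
    (((Matrix.diagonal fun i => M i i)⁻¹ + A)⁻¹
      - Matrix.diagonal fun i => (M⁻¹ + A)⁻¹ i i).PosSemidef := by
  obtain ⟨d, rfl⟩ : ∃ d, A = diagonal d := ⟨A.diag, hA_diag.diagonal_diag.symm⟩
  have hd : 0 ≤ d := posSemidef_diagonal_iff.mp hA
  have hinv : ∀ v : Fin m → ℝ, (∀ i, 0 < v i) → (diagonal v)⁻¹ = diagonal fun i => (v i)⁻¹ :=
    fun v hv => inv_eq_right_inv <| by
      simp [diagonal_mul_diagonal, fun i => mul_inv_cancel₀ (hv i).ne']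
  have hMpos : ∀ i, 0 < M i i := fun i => hM.diag_pos
  rw [hinv _ hMpos, diagonal_add,
    hinv _ fun i => add_pos_of_pos_of_nonneg (inv_pos.mpr (hMpos i)) (hd i), diagonal_sub]
  exact PosSemidef.diagonal fun i => sub_nonneg.mpr (hM.inv_add_diagonal_inv_diag_le hd i)
end

section
/- Let k = l₁ + l₂ and let K₁ and K₂ be k×k real symmetric positive definite matrices such that K₂⁻¹ − K₁⁻¹ = K, where K is the block-diagonal matrix diag(A, B) with A an l₁×l₁ diagonal positive semidefinite matrix and B an l₂×l₂ diagonal negative definite matrix. Let d₁, d₂ be positive reals with d₁·I ⪯ K₁ and d₂·I ⪯ K₂. Then d₁⁻¹·I + K is positive definite, and, setting D̂₁ := (d₁⁻¹·I + K)⁻¹ and letting G be the k×k block-diagonal matrix whose upper-left l₁×l₁ block is (D̂₁)_{l₁} and whose lower-right l₂×l₂ block is d₂·I, one has G ⪯ K₂. -/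
open Matrix

/-- For positive definite `X` and `Y`, `Y⁻¹ ⪯ X` implies `X⁻¹ ⪯ Y`. -/
theorem Matrix.PosDef.posSemidef_sub_inv_comm {n : Type*} [Fintype n] [DecidableEq n]
    {X Y : Matrix n n ℝ} (hX : X.PosDef) (hY : Y.PosDef) (h : (X - Y⁻¹).PosSemidef) :
    (Y - X⁻¹).PosSemidef := by
  have := hX.isUnit.invertible
  have := hY.isUnit.invertible
  have hXY := PosDef.fromBlocks₁₁ (1 : Matrix n n ℝ) Y hX
  have hYX := PosDef.fromBlocks₂₂ X (1 : Matrix n n ℝ) hY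
  simp only [conjTranspose_one, one_mul, mul_one] at hXY hYX
  exact hXY.1 (hYX.2 h)

/-- With `K₂⁻¹ − K₁⁻¹ = K = diag(A, B)` (`A` diagonal PSD, `B` diagonal
negative definite), `d₁·I ⪯ K₁`, `d₂·I ⪯ K₂`, the matrix `d₁⁻¹·I + K` is
positive definite, and setting `D̂₁ = (d₁⁻¹·I + K)⁻¹`, the block diagonal
matrix `G = diag((D̂₁)_{l₁}, d₂·I)` satisfies `G ⪯ K₂`. -/
theorem G_le_K2 (l₁ l₂ : ℕ)
    (K₁ K₂ : Matrix (Fin l₁ ⊕ Fin l₂) (Fin l₁ ⊕ Fin l₂) ℝ)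
    (hK₁ : K₁.PosDef) (hK₂ : K₂.PosDef)
    (A : Matrix (Fin l₁) (Fin l₁) ℝ) (hA_diag : A.IsDiag) (hA : A.PosSemidef)
    (B : Matrix (Fin l₂) (Fin l₂) ℝ) (hB_diag : B.IsDiag) (hB : (-B).PosDef)
    (K : Matrix (Fin l₁ ⊕ Fin l₂) (Fin l₁ ⊕ Fin l₂) ℝ)
    (hK_def : K = Matrix.fromBlocks A 0 0 B)
    (hK : K₂⁻¹ - K₁⁻¹ = K)
    (d₁ d₂ : ℝ) (hd₁ : 0 < d₁) (hd₂ : 0 < d₂)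
    (h₁ : (K₁ - d₁ • 1).PosSemidef) (h₂ : (K₂ - d₂ • 1).PosSemidef)
    (Dhat : Matrix (Fin l₁ ⊕ Fin l₂) (Fin l₁ ⊕ Fin l₂) ℝ)
    (hDhat : Dhat = (d₁⁻¹ • 1 + K)⁻¹)
    (G : Matrix (Fin l₁ ⊕ Fin l₂) (Fin l₁ ⊕ Fin l₂) ℝ)
    (hG : G = Matrix.fromBlocks (Matrix.toBlocks₁₁ Dhat) 0 0 (d₂ • 1)) :
    (d₁⁻¹ • (1 : Matrix (Fin l₁ ⊕ Fin l₂) (Fin l₁ ⊕ Fin l₂) ℝ) + K).PosDef ∧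
    (K₂ - G).PosSemidef := by
  have hd : (d₁⁻¹ • (1 : Matrix (Fin l₁ ⊕ Fin l₂) (Fin l₁ ⊕ Fin l₂) ℝ)).PosDef :=
    PosDef.one.smul (inv_pos.2 hd₁)
  have hd_inv : (d₁⁻¹ • (1 : Matrix (Fin l₁ ⊕ Fin l₂) (Fin l₁ ⊕ Fin l₂) ℝ))⁻¹ = d₁ • 1 := by
    apply inv_eq_right_inv
    simp [smul_smul, hd₁.ne']
  have hsub : (d₁⁻¹ • 1 - K₁⁻¹).PosSemidef :=
    hK₁.posSemidef_sub_inv_comm hd (by rwa [hd_inv])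
  have hM : (d₁⁻¹ • 1 + K).PosDef := by
    have := PosDef.posSemidef_add hsub hK₂.inv
    rwa [show d₁⁻¹ • 1 - K₁⁻¹ + K₂⁻¹ = d₁⁻¹ • 1 + K by rw [← hK]; abel] at this
  have hDhat_le : (K₂ - Dhat).PosSemidef := by
    rw [hDhat]
    refine hM.posSemidef_sub_inv_comm hK₂ ?_
    rwa [show d₁⁻¹ • 1 + K - K₂⁻¹ = d₁⁻¹ • 1 - K₁⁻¹ by rw [← hK]; abel]
  refine ⟨hM, ?_⟩
  have ha : ∀ i, 0 ≤ A i i := fun i => hA.diag_nonneg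
  have hb : ∀ i, B i i < 0 := fun i => by simpa using hB.diag_pos (i := i)
  have hM_diag : d₁⁻¹ • 1 + K =
      diagonal (Sum.elim (fun i => d₁⁻¹ + A i i) (fun i => d₁⁻¹ + B i i)) := by
    rw [hK_def, ← fromBlocks_diagonal, ← fromBlocks_one, fromBlocks_smul, fromBlocks_add]
    nth_rewrite 1 [← hA_diag.diagonal_diag]
    nth_rewrite 1 [← hB_diag.diagonal_diag]
    simp [smul_one_eq_diagonal, diagonal_add, diag]
  have hpos : ∀ i, 0 < d₁⁻¹ + B i i := fun i => by
    have := (posDef_diagonal_iff.1 (hM_diag ▸ hM)) (Sum.inr i)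
    simpa using this
  have hpos' : ∀ i, 0 < d₁⁻¹ + A i i := fun i => add_pos_of_pos_of_nonneg (inv_pos.2 hd₁) (ha i)
  have hD : Dhat =
      diagonal (Sum.elim (fun i => (d₁⁻¹ + A i i)⁻¹) (fun i => (d₁⁻¹ + B i i)⁻¹)) := by
    rw [hDhat, hM_diag]
    apply inv_eq_right_inv
    rw [diagonal_mul_diagonal, ← diagonal_one]
    congr 1
    ext (i | i)
    · simp [(hpos' i).ne']
    · simp [(hpos i).ne']
  have hG_diag : G = diagonal (Sum.elim (fun i => (d₁⁻¹ + A i i)⁻¹) (fun _ => d₂)) := by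
    rw [hG, hD, ← fromBlocks_diagonal, ← fromBlocks_diagonal, toBlocks_fromBlocks₁₁,
      smul_one_eq_diagonal]
  have hA_le : ∀ i, (d₁⁻¹ + A i i)⁻¹ ≤ d₁ := fun i =>
    inv_le_of_inv_le₀ hd₁ (by linarith [ha i])
  have hB_ge : ∀ i, d₁ ≤ (d₁⁻¹ + B i i)⁻¹ := fun i =>
    le_inv_of_le_inv₀ (hpos i) (by linarith [hb i])
  rcases le_total d₂ d₁ with h | h
  · rw [← sub_add_sub_cancel K₂ Dhat G]
    refine hDhat_le.add ?_
    rw [hD, hG_diag, diagonal_sub, posSemidef_diagonal_iff]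
    rintro (i | i)
    · simp
    · simpa using h.trans (hB_ge i)
  · rw [← sub_add_sub_cancel K₂ (d₂ • 1) G]
    refine h₂.add ?_
    rw [hG_diag, smul_one_eq_diagonal, diagonal_sub, posSemidef_diagonal_iff]
    rintro (i | i)
    · simpa using (hA_le i).trans h
    · simp
end

section
/- Let k = l₁ + l₂ and let K be the k×k block-diagonal matrix diag(A, B) with A an l₁×l₁ diagonal positive semidefinite matrix and B an l₂×l₂ diagonal negative definite matrix. Let d₁, d₂ be positive reals with d₁ ≤ d₂ such that d₁⁻¹·I + K is positive definite, set D̂₁ := (d₁⁻¹·I + K)⁻¹, and let G be the k×k block-diagonal matrix whose upper-left l₁×l₁ block is (D̂₁)_{l₁} and whose lower-right l₂×l₂ block is d₂·I. Then G is positive definite and G⁻¹ ⪰ d₂⁻¹·I. -/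
open Matrix

/-- The inverse of a diagonal matrix with nonzero entries is the diagonal of the inverses. -/
theorem inv_diagonal_of_ne_zero {n : Type*} [Fintype n] [DecidableEq n] {v : n → ℝ}
    (hv : ∀ i, v i ≠ 0) : (diagonal v)⁻¹ = diagonal fun i => (v i)⁻¹ := by
  refine Matrix.inv_eq_right_inv ?_
  rw [diagonal_mul_diagonal, ← diagonal_one]
  congr 1
  ext i
  exact mul_inv_cancel₀ (hv i)

/-- Case `d₁ ≤ d₂`: with `K = diag(A, B)` (`A` diagonal PSD, `B` diagonal
negative definite) and `d₁⁻¹·I + K` positive definite, setting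
`D̂₁ = (d₁⁻¹·I + K)⁻¹` and `G = diag((D̂₁)_{l₁}, d₂·I)`, the matrix `G` is
positive definite and `G⁻¹ ⪰ d₂⁻¹·I`. -/
theorem Ginv_ge_d2inv (l₁ l₂ : ℕ)
    (A : Matrix (Fin l₁) (Fin l₁) ℝ) (hA_diag : A.IsDiag) (hA : A.PosSemidef)
    (B : Matrix (Fin l₂) (Fin l₂) ℝ) (hB_diag : B.IsDiag) (hB : (-B).PosDef)
    (K : Matrix (Fin l₁ ⊕ Fin l₂) (Fin l₁ ⊕ Fin l₂) ℝ)
    (hK_def : K = Matrix.fromBlocks A 0 0 B)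
    (d₁ d₂ : ℝ) (hd₁ : 0 < d₁) (hd₂ : 0 < d₂) (hdd : d₁ ≤ d₂)
    (hpd : (d₁⁻¹ • (1 : Matrix (Fin l₁ ⊕ Fin l₂) (Fin l₁ ⊕ Fin l₂) ℝ) + K).PosDef)
    (Dhat : Matrix (Fin l₁ ⊕ Fin l₂) (Fin l₁ ⊕ Fin l₂) ℝ)
    (hDhat : Dhat = (d₁⁻¹ • 1 + K)⁻¹)
    (G : Matrix (Fin l₁ ⊕ Fin l₂) (Fin l₁ ⊕ Fin l₂) ℝ)
    (hG : G = Matrix.fromBlocks (Matrix.toBlocks₁₁ Dhat) 0 0 (d₂ • 1)) :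
    G.PosDef ∧ (G⁻¹ - d₂⁻¹ • 1).PosSemidef := by
  obtain ⟨a, rfl⟩ : ∃ a, A = diagonal a := ⟨A.diag, hA_diag.diagonal_diag.symm⟩
  obtain ⟨b, rfl⟩ : ∃ b, B = diagonal b := ⟨B.diag, hB_diag.diagonal_diag.symm⟩
  have ha : ∀ i, 0 ≤ a i := posSemidef_diagonal_iff.mp hA
  have hdiag : d₁⁻¹ • (1 : Matrix (Fin l₁ ⊕ Fin l₂) (Fin l₁ ⊕ Fin l₂) ℝ) + K =
      diagonal fun i => d₁⁻¹ + Sum.elim a b i := by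
    rw [hK_def, fromBlocks_diagonal, smul_one_eq_diagonal, diagonal_add]
  have hpos : ∀ i, 0 < d₁⁻¹ + Sum.elim a b i := by
    rw [hdiag] at hpd
    exact posDef_diagonal_iff.mp hpd
  have hG_diag : G = diagonal (Sum.elim (fun i => (d₁⁻¹ + a i)⁻¹) fun _ => d₂) := by
    have hblock : (diagonal fun i => (d₁⁻¹ + Sum.elim a b i)⁻¹).toBlocks₁₁ =
        diagonal fun i => (d₁⁻¹ + a i)⁻¹ := by
      ext i j
      simp [toBlocks₁₁, diagonal_apply]
    rw [hG, hDhat, hdiag, inv_diagonal_of_ne_zero fun i => (hpos i).ne', hblock,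
      smul_one_eq_diagonal, fromBlocks_diagonal]
  have hG_pos : ∀ i, 0 < Sum.elim (fun i => (d₁⁻¹ + a i)⁻¹) (fun _ : Fin l₂ => d₂) i := by
    rintro (i | i)
    · exact inv_pos.mpr (hpos (Sum.inl i))
    · exact hd₂
  rw [hG_diag]
  refine ⟨posDef_diagonal_iff.mpr hG_pos, ?_⟩
  rw [inv_diagonal_of_ne_zero fun i => (hG_pos i).ne', smul_one_eq_diagonal, diagonal_sub]
  refine posSemidef_diagonal_iff.mpr ?_
  rintro (i | i)
  · have hinv : d₂⁻¹ ≤ d₁⁻¹ := inv_anti₀ hd₁ hdd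
    simp only [Sum.elim_inl, inv_inv]
    linarith [ha i]
  · simp
end

section
/- Let k = l₁ + l₂ and let K be the k×k block-diagonal matrix diag(A, B) with A an l₁×l₁ diagonal positive semidefinite matrix and B an l₂×l₂ diagonal negative definite matrix. Let d₁, d₂ be positive reals such that d₁⁻¹·I + K is positive definite, set D̂₁ := (d₁⁻¹·I + K)⁻¹, and let G be the k×k block-diagonal matrix whose upper-left l₁×l₁ block is (D̂₁)_{l₁} and whose lower-right l₂×l₂ block is d₂·I. Then G⁻¹ − K is the block-diagonal matrix diag(d₁⁻¹·I_{l₁}, d₂⁻¹·I_{l₂} − B); in particular G⁻¹ − K is positive definite and (G⁻¹ − K)⁻¹ is the block-diagonal matrix whose upper-left l₁×l₁ block is d₁·I and whose lower-right l₂×l₂ block is (d₂⁻¹·I − B)⁻¹. -/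
open Matrix

/-- A block-diagonal matrix with positive definite blocks is positive definite. -/
theorem Matrix.PosDef.fromBlocks_diagonal {m n : Type*} [Fintype m] [Fintype n]
    {P : Matrix m m ℝ} {Q : Matrix n n ℝ} (hP : P.PosDef) (hQ : Q.PosDef) :
    (fromBlocks P 0 0 Q).PosDef := by
  refine Matrix.PosDef.of_dotProduct_mulVec_pos
    (IsHermitian.fromBlocks hP.isHermitian (by simp) hQ.isHermitian) fun x hx => ?_
  obtain ⟨u, v, rfl⟩ : ∃ u v, x = Sum.elim u v := ⟨_, _, (Sum.elim_comp_inl_inr x).symm⟩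
  have hsplit : star (Sum.elim u v) ⬝ᵥ (fromBlocks P 0 0 Q *ᵥ Sum.elim u v) =
      star u ⬝ᵥ (P *ᵥ u) + star v ⬝ᵥ (Q *ᵥ v) := by
    simp [fromBlocks_mulVec, dotProduct]
  rw [hsplit]
  by_cases hu : u = 0
  · have hv : v ≠ 0 := by
      rintro rfl
      exact hx (by subst hu; ext (i | i) <;> rfl)
    exact add_pos_of_nonneg_of_pos (hP.posSemidef.dotProduct_mulVec_nonneg u)
      (hQ.dotProduct_mulVec_pos hv)
  · exact add_pos_of_pos_of_nonneg (hP.dotProduct_mulVec_pos hu)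
      (hQ.posSemidef.dotProduct_mulVec_nonneg v)

/-- The inverse of a block-diagonal matrix with invertible blocks is computed blockwise. -/
theorem Matrix.inv_fromBlocks_diagonal {m n R : Type*} [Fintype m] [Fintype n]
    [DecidableEq m] [DecidableEq n] [CommRing R] {P : Matrix m m R} {Q : Matrix n n R}
    (hP : IsUnit P) (hQ : IsUnit Q) :
    (fromBlocks P 0 0 Q)⁻¹ = fromBlocks P⁻¹ 0 0 Q⁻¹ := by
  simp [inv_fromBlocks_zero₂₁_of_isUnit_iff P 0 Q (iff_of_true hP hQ)]

/-- With `K = diag(A, B)` (`A` diagonal PSD, `B` diagonal negative definite),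
`d₁⁻¹·I + K` positive definite, `D̂₁ = (d₁⁻¹·I + K)⁻¹` and
`G = diag((D̂₁)_{l₁}, d₂·I)`: one has
`G⁻¹ − K = diag(d₁⁻¹·I, d₂⁻¹·I − B)`, this matrix is positive definite, and
`(G⁻¹ − K)⁻¹ = diag(d₁·I, (d₂⁻¹·I − B)⁻¹)`. -/
theorem Ginv_sub_K_eq (l₁ l₂ : ℕ)
    (A : Matrix (Fin l₁) (Fin l₁) ℝ) (hA_diag : A.IsDiag) (hA : A.PosSemidef)
    (B : Matrix (Fin l₂) (Fin l₂) ℝ) (hB_diag : B.IsDiag) (hB : (-B).PosDef)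
    (K : Matrix (Fin l₁ ⊕ Fin l₂) (Fin l₁ ⊕ Fin l₂) ℝ)
    (hK_def : K = Matrix.fromBlocks A 0 0 B)
    (d₁ d₂ : ℝ) (hd₁ : 0 < d₁) (hd₂ : 0 < d₂)
    (hpd : (d₁⁻¹ • (1 : Matrix (Fin l₁ ⊕ Fin l₂) (Fin l₁ ⊕ Fin l₂) ℝ) + K).PosDef)
    (Dhat : Matrix (Fin l₁ ⊕ Fin l₂) (Fin l₁ ⊕ Fin l₂) ℝ)
    (hDhat : Dhat = (d₁⁻¹ • 1 + K)⁻¹)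
    (G : Matrix (Fin l₁ ⊕ Fin l₂) (Fin l₁ ⊕ Fin l₂) ℝ)
    (hG : G = Matrix.fromBlocks (Matrix.toBlocks₁₁ Dhat) 0 0 (d₂ • 1)) :
    G⁻¹ - K = Matrix.fromBlocks (d₁⁻¹ • 1) 0 0 (d₂⁻¹ • 1 - B) ∧
    (G⁻¹ - K).PosDef ∧
    (G⁻¹ - K)⁻¹ = Matrix.fromBlocks (d₁ • 1) 0 0 ((d₂⁻¹ • 1 - B)⁻¹) := by
  subst hK_def
  have hone₁ : (d₁⁻¹ • (1 : Matrix (Fin l₁) (Fin l₁) ℝ)).PosDef :=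
    PosDef.one.smul (inv_pos.mpr hd₁)
  have hone₂ : (d₂⁻¹ • (1 : Matrix (Fin l₂) (Fin l₂) ℝ)).PosDef :=
    PosDef.one.smul (inv_pos.mpr hd₂)
  have hC : (d₂⁻¹ • 1 - B).PosDef := by
    rw [sub_eq_add_neg]
    exact hone₂.add hB
  have hP : (d₁⁻¹ • 1 + A).PosDef := hone₁.add_posSemidef hA
  have hblocks : d₁⁻¹ • (1 : Matrix (Fin l₁ ⊕ Fin l₂) (Fin l₁ ⊕ Fin l₂) ℝ)
      + fromBlocks A 0 0 B = fromBlocks (d₁⁻¹ • 1 + A) 0 0 (d₁⁻¹ • 1 + B) := by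
    rw [← fromBlocks_one, fromBlocks_smul, fromBlocks_add]
    simp
  have hQ : IsUnit (d₁⁻¹ • 1 + B) := by
    have hunit := hpd.isUnit
    rw [hblocks, isUnit_fromBlocks_zero₂₁] at hunit
    exact hunit.2
  have inv_smul_one {n : ℕ} {d : ℝ} (hd : 0 < d) :
      (d • (1 : Matrix (Fin n) (Fin n) ℝ))⁻¹ = d⁻¹ • 1 :=
    inv_eq_right_inv (by simp [smul_smul, hd.ne'])
  have hGinv : G⁻¹ = fromBlocks (d₁⁻¹ • 1 + A) 0 0 (d₂⁻¹ • 1) := by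
    rw [hG, hDhat, hblocks, inv_fromBlocks_diagonal hP.isUnit hQ, toBlocks_fromBlocks₁₁,
      inv_fromBlocks_diagonal hP.inv.isUnit (PosDef.one.smul hd₂).isUnit,
      nonsing_inv_nonsing_inv _ ((isUnit_iff_isUnit_det _).mp hP.isUnit), inv_smul_one hd₂]
  have hsub : G⁻¹ - fromBlocks A 0 0 B = fromBlocks (d₁⁻¹ • 1) 0 0 (d₂⁻¹ • 1 - B) := by
    rw [hGinv, sub_eq_iff_eq_add, fromBlocks_add]
    simp
  refine ⟨hsub, hsub ▸ hone₁.fromBlocks_diagonal hC, ?_⟩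
  rw [hsub, inv_fromBlocks_diagonal hone₁.isUnit hC.isUnit, inv_smul_one (inv_pos.mpr hd₁),
    inv_inv]
end
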